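/- Let n and r be integers with 1 ≤ r < n. Let X_{n,r} be the set of pairs (π, c) with π ∈ S_{n-1} and c an integer satisfying exc_r(π) + r - 1 < c ≤ |Excp_r(π)| + r - 1. Then there exists an injection α from X_{n,r} into S*_{n,r} such that for every (π,c) ∈ X_{n,r}: exc_r(α(π,c)) = exc_r(π) + 1 and den_r(α(π,c)) = den_r(π) + c. -/

import Mathlib

open Finset

/-- The value of the permutation `π ∈ S_n` at the (1-based) position `i`,
in one-line notation with letters `1,…,n`; `0` if `i` is out of range. -/
def pval {n : ℕ} (π : Equiv.Perm (Fin n)) (i : ℕ) : ℕ :=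
  if h : 1 ≤ i ∧ i ≤ n then ((π ⟨i - 1, by omega⟩ : Fin n) : ℕ) + 1 else 0

/-- The number of inversions of a word `w`, i.e. pairs of positions `i < j`
with `w_i > w_j`. -/
def winv (w : List ℕ) : ℕ :=
  ((Finset.range w.length ×ˢ Finset.range w.length).filter
    (fun p => p.1 < p.2 ∧ w.getD p.2 0 < w.getD p.1 0)).card

/-- `rDes(π) = {i ∈ [n-1] : π_i ≥ π_{i+1} + r}`. -/
def rDesSet {n : ℕ} (r : ℕ) (π : Equiv.Perm (Fin n)) : Finset ℕ :=
  (Finset.Icc 1 (n - 1)).filter (fun i => pval π (i + 1) + r ≤ pval π i)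

/-- The `r`-descent number `rdes(π)`. -/
def rdes {n : ℕ} (r : ℕ) (π : Equiv.Perm (Fin n)) : ℕ := (rDesSet r π).card

/-- `rInv(π) = {(i,j) : i < j, π_i > π_j, π_i < π_j + r}`. -/
def rInvSet {n : ℕ} (r : ℕ) (π : Equiv.Perm (Fin n)) : Finset (ℕ × ℕ) :=
  ((Finset.Icc 1 n) ×ˢ (Finset.Icc 1 n)).filter
    (fun p => p.1 < p.2 ∧ pval π p.2 < pval π p.1 ∧ pval π p.1 < pval π p.2 + r)

/-- The `r`-major index `rmaj(π) = ∑_{i ∈ rDes(π)} i + |rInv(π)|`. -/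
def rmaj {n : ℕ} (r : ℕ) (π : Equiv.Perm (Fin n)) : ℕ :=
  (∑ i ∈ rDesSet r π, i) + (rInvSet r π).card

/-- The inversion number `inv(π)`: the number of pairs `i < j` with `π_i > π_j`. -/
def invStat {n : ℕ} (π : Equiv.Perm (Fin n)) : ℕ :=
  (((Finset.Icc 1 n) ×ˢ (Finset.Icc 1 n)).filter
    (fun p => p.1 < p.2 ∧ pval π p.2 < pval π p.1)).card

/-- `Excp_r(π)`: the set of `r`-level excedance places, i.e. indices `i`
with `π_i > i` and `π_i ≥ r`. -/
def excpSet {n : ℕ} (r : ℕ) (π : Equiv.Perm (Fin n)) : Finset ℕ :=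
  (Finset.Icc 1 n).filter (fun i => i < pval π i ∧ r ≤ pval π i)

/-- `Exc_r(π)`: the subword of `π` on the `r`-level excedance places,
in increasing order of position. -/
def excWord {n : ℕ} (r : ℕ) (π : Equiv.Perm (Fin n)) : List ℕ :=
  ((excpSet r π).sort (· ≤ ·)).map (pval π)

/-- `Nexc_r(π)`: the subword of `π` on the non-`r`-level-excedance places,
in increasing order of position. -/
def nexcWord {n : ℕ} (r : ℕ) (π : Equiv.Perm (Fin n)) : List ℕ :=
  (((Finset.Icc 1 n) \ excpSet r π).sort (· ≤ ·)).map (pval π)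

/-- The `r`-level Denert statistic
`den_r(π) = ∑_{i ∈ Excp_r(π)} i + inv(Exc_r(π)) + inv(Nexc_r(π))`. -/
def denr {n : ℕ} (r : ℕ) (π : Equiv.Perm (Fin n)) : ℕ :=
  (∑ i ∈ excpSet r π, i) + winv (excWord r π) + winv (nexcWord r π)

/-- The `r`-level excedance number `exc_r(π) = |{i : π_i > i ≥ r}|`. -/
def excr {n : ℕ} (r : ℕ) (π : Equiv.Perm (Fin n)) : ℕ :=
  ((Finset.Icc 1 n).filter (fun i => r ≤ i ∧ i < pval π i)).card

/-- `i` is a grande-fixed place of `τ`: either `τ_i = i`, or `τ_i > i` and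
there is no index `j` with `τ_j > j` and `i ≤ τ_j < τ_i`. -/
def grandeFixedPlace {n : ℕ} (τ : Equiv.Perm (Fin n)) (i : ℕ) : Prop :=
  1 ≤ i ∧ i ≤ n ∧
    (pval τ i = i ∨
      (i < pval τ i ∧ ∀ j, 1 ≤ j → j ≤ n → j < pval τ j →
        ¬ (i ≤ pval τ j ∧ pval τ j < pval τ i)))

/-- `S_{n,r}`: the set of permutations in `S_n` with no `r`-level grande-fixed
place (a grande-fixed place `i` with `i ≥ r`). -/
def Snr (n r : ℕ) : Set (Equiv.Perm (Fin n)) :=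
  {τ | ¬ ∃ i, r ≤ i ∧ grandeFixedPlace τ i}

/-- `S*_{n,r} = {τ ∈ S_{n,r} : τ_r > r}`. -/
def SnrStar (n r : ℕ) : Set (Equiv.Perm (Fin n)) :=
  {τ ∈ Snr n r | r < pval τ r}

/-- `X_{n,r}`: pairs (π, c) with π ∈ S_{n-1} and
exc_r(π) + r - 1 < c ≤ |Excp_r(π)| + r - 1. -/
def Xnr (n r : ℕ) : Set (Equiv.Perm (Fin (n - 1)) × ℕ) :=
  {p | excr r p.1 + r - 1 < p.2 ∧ p.2 ≤ (excpSet r p.1).card + r - 1}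

/-- The number of inversions of `f` restricted to the finite set of positions `S`. -/
def invOn (S : Finset ℕ) (f : ℕ → ℕ) : ℕ :=
  ((S ×ˢ S).filter (fun p => p.1 < p.2 ∧ f p.2 < f p.1)).card

lemma winv_sort_map (S : Finset ℕ) (f : ℕ → ℕ) :
    winv ((S.sort (· ≤ ·)).map f) = invOn S f := by
  unfold winv invOn
  set l := S.sort (· ≤ ·) with hl
  have hmono : StrictMono l.get := (Finset.sortedLT_sort S).strictMono_get
  have hmem : ∀ x, x ∈ l ↔ x ∈ S := fun x => Finset.mem_sort _
  have hget : ∀ i (h : i < l.length), (l.map f).getD i 0 = f (l.get ⟨i, h⟩) := by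
    intro i h
    simp [List.getD_eq_getElem?_getD, h]
  refine Finset.card_bij (fun p _ => (l.getD p.1 0, l.getD p.2 0)) ?_ ?_ ?_
  · rintro ⟨a, b⟩ h
    simp only [List.length_map, Finset.mem_filter, Finset.mem_product, Finset.mem_range] at h
    obtain ⟨⟨ha, hb⟩, hab, hf⟩ := h
    rw [hget a ha, hget b hb] at hf
    have hlt : l.get ⟨a, ha⟩ < l.get ⟨b, hb⟩ := hmono hab
    have hma : l.get ⟨a, ha⟩ ∈ S := (hmem _).1 (List.get_mem _ _)
    have hmb : l.get ⟨b, hb⟩ ∈ S := (hmem _).1 (List.get_mem _ _)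
    simp only [Finset.mem_filter, Finset.mem_product, List.getD_eq_getElem _ _ ha,
      List.getD_eq_getElem _ _ hb]
    exact ⟨⟨hma, hmb⟩, hlt, hf⟩
  · rintro ⟨a, b⟩ h ⟨a', b'⟩ h' heq
    simp only [List.length_map, Finset.mem_filter, Finset.mem_product, Finset.mem_range] at h h'
    obtain ⟨⟨ha, hb⟩, -, -⟩ := h
    obtain ⟨⟨ha', hb'⟩, -, -⟩ := h'
    simp only [List.getD_eq_getElem _ _ ha, List.getD_eq_getElem _ _ hb,
      List.getD_eq_getElem _ _ ha', List.getD_eq_getElem _ _ hb', Prod.mk.injEq] at heq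
    have h1 := hmono.injective (a₁ := ⟨a, ha⟩) (a₂ := ⟨a', ha'⟩) heq.1
    have h2 := hmono.injective (a₁ := ⟨b, hb⟩) (a₂ := ⟨b', hb'⟩) heq.2
    simp only [Fin.mk.injEq] at h1 h2
    rw [h1, h2]
  · rintro ⟨x, y⟩ h
    simp only [Finset.mem_filter, Finset.mem_product] at h
    obtain ⟨⟨hx, hy⟩, hxy, hf⟩ := h
    obtain ⟨⟨a, ha⟩, rfl⟩ := List.get_of_mem ((hmem x).2 hx)
    obtain ⟨⟨b, hb⟩, rfl⟩ := List.get_of_mem ((hmem y).2 hy)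
    refine ⟨(a, b), ?_, ?_⟩
    · simp only [List.length_map, Finset.mem_filter, Finset.mem_product, Finset.mem_range]
      rw [hget a ha, hget b hb]
      exact ⟨⟨ha, hb⟩, hmono.lt_iff_lt.1 hxy, hf⟩
    · simp only [List.getD_eq_getElem _ _ ha, List.getD_eq_getElem _ _ hb, List.get_eq_getElem]

lemma invOn_congr {S : Finset ℕ} {f g : ℕ → ℕ}
    (h : ∀ i ∈ S, ∀ j ∈ S, i < j → (f j < f i ↔ g j < g i)) : invOn S f = invOn S g := by
  unfold invOn
  congr 1
  apply Finset.filter_congr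
  rintro ⟨i, j⟩ hij
  rw [Finset.mem_product] at hij
  exact and_congr_right fun hlt => h i hij.1 j hij.2 hlt

lemma invOn_image {S : Finset ℕ} {g : ℕ → ℕ} (hg : StrictMono g) (f : ℕ → ℕ) :
    invOn (S.image g) f = invOn S (f ∘ g) := by
  unfold invOn
  symm
  refine Finset.card_bij (fun p _ => (g p.1, g p.2)) ?_ ?_ ?_
  · rintro ⟨a, b⟩ h
    simp only [Finset.mem_filter, Finset.mem_product, Function.comp] at h ⊢
    exact ⟨⟨Finset.mem_image_of_mem _ h.1.1, Finset.mem_image_of_mem _ h.1.2⟩,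
      hg h.2.1, h.2.2⟩
  · rintro ⟨a, b⟩ - ⟨a', b'⟩ - heq
    rw [Prod.mk.injEq] at heq ⊢
    exact ⟨hg.injective heq.1, hg.injective heq.2⟩
  · rintro ⟨x, y⟩ h
    simp only [Finset.mem_filter, Finset.mem_product, Finset.mem_image] at h
    obtain ⟨⟨⟨a, ha, rfl⟩, b, hb, rfl⟩, hab, hf⟩ := h
    refine ⟨(a, b), ?_, rfl⟩
    simp only [Finset.mem_filter, Finset.mem_product, Function.comp]
    exact ⟨⟨ha, hb⟩, hg.lt_iff_lt.1 hab, hf⟩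

lemma invOn_union {A B : Finset ℕ} (hAB : ∀ a ∈ A, ∀ b ∈ B, a < b) (f : ℕ → ℕ) :
    invOn (A ∪ B) f
      = invOn A f + invOn B f + ∑ j ∈ B, (A.filter (fun i => f j < f i)).card := by
  have hcross : ∑ j ∈ B, (A.filter (fun i => f j < f i)).card
      = ((A ×ˢ B).filter (fun p => p.1 < p.2 ∧ f p.2 < f p.1)).card := by
    rw [Finset.card_filter, Finset.sum_product_right]
    refine Finset.sum_congr rfl fun j hj => ?_
    rw [Finset.card_filter]
    refine Finset.sum_congr rfl fun i hi => ?_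
    simp [hAB i hi j hj]
  have hback : (B ×ˢ A).filter (fun p => p.1 < p.2 ∧ f p.2 < f p.1) = ∅ := by
    refine Finset.filter_eq_empty_iff.2 ?_
    rintro ⟨i, j⟩ hij h
    rw [Finset.mem_product] at hij
    exact absurd h.1 (hAB j hij.2 i hij.1).not_gt
  have hdisj : Disjoint A B :=
    Finset.disjoint_left.2 fun a ha hb => (hAB a ha a hb).false
  rw [hcross]
  unfold invOn
  rw [Finset.union_product, Finset.product_union, Finset.product_union, Finset.filter_union,
    Finset.filter_union, Finset.filter_union, hback, Finset.empty_union,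
    Finset.card_union_of_disjoint, Finset.card_union_of_disjoint]
  · ring
  · exact Finset.disjoint_filter_filter (Finset.disjoint_product.2 (Or.inr hdisj))
  · rw [Finset.disjoint_union_left]
    exact ⟨Finset.disjoint_filter_filter (Finset.disjoint_product.2 (Or.inl hdisj)),
      Finset.disjoint_filter_filter (Finset.disjoint_product.2 (Or.inl hdisj))⟩

lemma pval_mem {m : ℕ} (π : Equiv.Perm (Fin m)) {i : ℕ} (h1 : 1 ≤ i) (h2 : i ≤ m) :
    1 ≤ pval π i ∧ pval π i ≤ m := by
  rw [pval, dif_pos ⟨h1, h2⟩]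
  omega

lemma pval_injOn {m : ℕ} (π : Equiv.Perm (Fin m)) {i j : ℕ} (hi : 1 ≤ i ∧ i ≤ m)
    (hj : 1 ≤ j ∧ j ≤ m) (h : pval π i = pval π j) : i = j := by
  rw [pval, pval, dif_pos hi, dif_pos hj, Nat.add_right_cancel_iff, Fin.val_inj,
    EmbeddingLike.apply_eq_iff_eq, Fin.mk.injEq] at h
  omega

lemma perm_ext_pval {m : ℕ} {π σ : Equiv.Perm (Fin m)}
    (h : ∀ i, 1 ≤ i → i ≤ m → pval π i = pval σ i) : π = σ := by
  ext x
  have := h (x + 1) (by omega) (by omega)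
  simpa [pval] using this

lemma exists_perm_pval {m : ℕ} {f : ℕ → ℕ} (hmaps : ∀ i, 1 ≤ i → i ≤ m → 1 ≤ f i ∧ f i ≤ m)
    (hinj : ∀ i j, 1 ≤ i → i ≤ m → 1 ≤ j → j ≤ m → f i = f j → i = j) :
    ∃ τ : Equiv.Perm (Fin m), ∀ i, 1 ≤ i → i ≤ m → pval τ i = f i := by
  let g : Fin m → Fin m := fun x => ⟨f (x + 1) - 1, by
    have := hmaps (x + 1) (by omega) (by omega)
    omega⟩
  have hg : Function.Injective g := by
    intro x y hxy
    have hx := hmaps (x + 1) (by omega) (by omega)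
    have hy := hmaps (y + 1) (by omega) (by omega)
    have := hinj (x + 1) (y + 1) (by omega) (by omega) (by omega) (by omega)
      (by simp only [g, Fin.mk.injEq] at hxy; omega)
    omega
  refine ⟨Equiv.ofBijective g (Finite.injective_iff_bijective.1 hg), fun i h1 h2 => ?_⟩
  have := hmaps i h1 h2
  simp only [pval, h1, h2, and_self, dite_true, Equiv.ofBijective_apply, g]
  rw [Nat.sub_add_cancel h1]
  omega

/-- `C` sends every element of `F` to the next larger one, and the largest to the smallest. -/
structure IsCyclicSucc (F : Finset ℕ) (C : Equiv.Perm ℕ) : Prop where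
  apply_of_notMem : ∀ x ∉ F, C x = x
  lt_apply : ∀ x ∈ F, ∀ y ∈ F, x < y → x < C x
  apply_le : ∀ x ∈ F, ∀ y ∈ F, x < y → C x ≤ y
  apply_max_le : ∀ x ∈ F, (∀ y ∈ F, y ≤ x) → ∀ y ∈ F, C x ≤ y
  apply_mem : ∀ x ∈ F, C x ∈ F

lemma exists_isCyclicSucc (F : Finset ℕ) : ∃ C, IsCyclicSucc F C := by
  induction F using Finset.induction_on_max with
  | empty => exact ⟨1, by constructor <;> simp⟩
  | insert a F ha ih =>
    obtain ⟨C, hC⟩ := ih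
    have haF : a ∉ F := fun h => (ha a h).false
    have hCa := hC.apply_of_notMem a haF
    rcases F.eq_empty_or_nonempty with rfl | hne
    · exact ⟨1, by constructor <;> simp⟩
    set b := F.max' hne with hb
    have hbF : b ∈ F := F.max'_mem hne
    have hmax : ∀ y ∈ F, y ≤ b := fun y hy => F.le_max' y hy
    have hba := ha b hbF
    have h1 : (C * Equiv.swap a b) a = C b := by simp
    have h2 : (C * Equiv.swap a b) b = a := by simp [hCa]
    have h3 : ∀ x, x ≠ a → x ≠ b → (C * Equiv.swap a b) x = C x := fun x hxa hxb => by
      simp [Equiv.swap_apply_of_ne_of_ne hxa hxb]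
    refine ⟨C * Equiv.swap a b, ?_, ?_, ?_, ?_, ?_⟩
    · intro x hx
      rw [Finset.mem_insert, not_or] at hx
      rw [h3 x hx.1 (fun h => hx.2 (h ▸ hbF)), hC.apply_of_notMem x hx.2]
    · intro x hx y hy hxy
      have hxa : x < a := by
        rcases Finset.mem_insert.1 hy with rfl | hy
        · exact hxy
        · exact hxy.trans (ha y hy)
      have hxF := (Finset.mem_insert.1 hx).resolve_left hxa.ne
      rcases eq_or_ne x b with h | h
      · rw [h, h2]; exact hba
      · rw [h3 x hxa.ne h]
        exact hC.lt_apply x hxF b hbF (lt_of_le_of_ne (hmax x hxF) h)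
    · intro x hx y hy hxy
      have hxa : x < a := by
        rcases Finset.mem_insert.1 hy with rfl | hy
        · exact hxy
        · exact hxy.trans (ha y hy)
      have hxF := (Finset.mem_insert.1 hx).resolve_left hxa.ne
      rcases eq_or_ne x b with h | h
      · rw [h, h2]
        rcases Finset.mem_insert.1 hy with rfl | hy
        · exact le_rfl
        · exact absurd (hmax y hy) (by omega)
      · rw [h3 x hxa.ne h]
        rcases Finset.mem_insert.1 hy with rfl | hy
        · exact (hC.apply_le x hxF b hbF (lt_of_le_of_ne (hmax x hxF) h)).trans hba.le
        · exact hC.apply_le x hxF y hy hxy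
    · intro x hx hxm y hy
      have hxa : x = a := by
        rcases Finset.mem_insert.1 hx with h | h
        · exact h
        · exact absurd (hxm a (Finset.mem_insert_self _ _)) (ha x h).not_ge
      rw [hxa, h1]
      rcases Finset.mem_insert.1 hy with rfl | hy
      · exact (ha _ (hC.apply_mem b hbF)).le
      · exact hC.apply_max_le b hbF hmax y hy
    · intro x hx
      rcases eq_or_ne x a with h | hxa
      · rw [h, h1]; exact Finset.mem_insert_of_mem (hC.apply_mem b hbF)
      rcases eq_or_ne x b with h | hxb
      · rw [h, h2]; exact Finset.mem_insert_self _ _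
      rw [h3 x hxa hxb]
      exact Finset.mem_insert_of_mem
        (hC.apply_mem x ((Finset.mem_insert.1 hx).resolve_left hxa))

/-- The cyclic successor permutation of a finite set. -/
noncomputable def cyclicSucc (F : Finset ℕ) : Equiv.Perm ℕ := (exists_isCyclicSucc F).choose

lemma cyclicSucc_spec (F : Finset ℕ) : IsCyclicSucc F (cyclicSucc F) :=
  (exists_isCyclicSucc F).choose_spec

lemma image_cyclicSucc {F G : Finset ℕ} (h : F ⊆ G) : G.image (cyclicSucc F) = G := by
  refine Finset.eq_of_subset_of_card_le (Finset.image_subset_iff.2 fun x hx => ?_)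
    (Finset.card_image_of_injective _ (cyclicSucc F).injective).ge
  by_cases hF : x ∈ F
  · exact h ((cyclicSucc_spec F).apply_mem x hF)
  · rwa [(cyclicSucc_spec F).apply_of_notMem x hF]

lemma image_cyclicSucc_symm {F G : Finset ℕ} (h : F ⊆ G) :
    G.image (cyclicSucc F).symm = G := by
  conv_lhs => rw [← image_cyclicSucc h]
  simp [Finset.image_image]

lemma cyclicSucc_symm_of_notMem {F : Finset ℕ} {x : ℕ} (h : x ∉ F) :
    (cyclicSucc F).symm x = x := by
  rw [Equiv.symm_apply_eq, (cyclicSucc_spec F).apply_of_notMem x h]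

lemma cyclicSucc_symm_mem {F : Finset ℕ} {x : ℕ} (h : x ∈ F) :
    (cyclicSucc F).symm x ∈ F := by
  have := Finset.mem_image_of_mem (cyclicSucc F).symm h
  rwa [image_cyclicSucc_symm subset_rfl] at this

lemma cyclicSucc_lt_cyclicSucc {F : Finset ℕ} {x y z : ℕ} (hx : x ∈ F) (hy : y ∈ F)
    (hz : z ∈ F) (hxy : x < y) (hyz : y < z) : cyclicSucc F x < cyclicSucc F y :=
  ((cyclicSucc_spec F).apply_le x hx y hy hxy).trans_lt
    ((cyclicSucc_spec F).lt_apply y hy z hz hyz)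

lemma cyclicSucc_symm_min {F : Finset ℕ} {x v : ℕ} (hx : x ∈ F) (hv : v ∈ F)
    (hmin : ∀ y ∈ F, x ≤ y) (hmax : ∀ y ∈ F, y ≤ v) : (cyclicSucc F).symm x = v := by
  rw [Equiv.symm_apply_eq]
  exact le_antisymm (hmin _ ((cyclicSucc_spec F).apply_mem v hv))
    ((cyclicSucc_spec F).apply_max_le v hv hmax x hx)

lemma cyclicSucc_symm_lt {F : Finset ℕ} {x y : ℕ} (hx : x ∈ F) (hy : y ∈ F) (h : y < x) :
    (cyclicSucc F).symm x < x := by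
  have hz := cyclicSucc_symm_mem hx
  have hzx : cyclicSucc F ((cyclicSucc F).symm x) = x := Equiv.apply_symm_apply _ _
  by_cases hm : ∃ w ∈ F, (cyclicSucc F).symm x < w
  · obtain ⟨w, hw, hlt⟩ := hm
    have := (cyclicSucc_spec F).lt_apply _ hz w hw hlt
    rwa [hzx] at this
  · push Not at hm
    have := (cyclicSucc_spec F).apply_max_le _ hz hm y hy
    omega

lemma cyclicSucc_symm_lt_symm {F : Finset ℕ} {w x y : ℕ} (hw : w ∈ F) (hx : x ∈ F)
    (hy : y ∈ F) (hwx : w < x) (hxy : x < y) :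
    (cyclicSucc F).symm x < (cyclicSucc F).symm y := by
  by_contra hcon
  have hne : (cyclicSucc F).symm y ≠ (cyclicSucc F).symm x := fun h =>
    hxy.ne' ((cyclicSucc F).symm.injective h)
  have := (cyclicSucc_spec F).apply_le _ (cyclicSucc_symm_mem hy) _ (cyclicSucc_symm_mem hx)
    (by omega)
  rw [Equiv.apply_symm_apply] at this
  have := cyclicSucc_symm_lt hx hw hwx
  omega

lemma exists_card_filter_gt (W : Finset ℕ) {t : ℕ} (ht : t < W.card) :
    ∃ v ∈ W, (W.filter (fun w => v < w)).card = t := by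
  induction W using Finset.induction_on_max generalizing t with
  | empty => simp at ht
  | insert a W ha ih =>
    have haW : a ∉ W := fun h => (ha a h).false
    rw [Finset.card_insert_of_notMem haW] at ht
    rcases t with _ | t
    · refine ⟨a, Finset.mem_insert_self _ _, ?_⟩
      rw [Finset.card_eq_zero, Finset.filter_eq_empty_iff]
      intro x hx
      rcases Finset.mem_insert.1 hx with rfl | hx
      · simp
      · exact (ha x hx).not_gt
    · obtain ⟨v, hv, hcard⟩ := ih (t := t) (by omega)
      refine ⟨v, Finset.mem_insert_of_mem hv, ?_⟩
      rw [Finset.filter_insert, if_pos (ha v hv), Finset.card_insert_of_notMem, hcard]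
      exact fun h => haW (Finset.mem_filter.1 h).1

/-- The position in a word of a letter at position `i` after a letter is inserted at
position `r`. -/
def shiftPlace (r i : ℕ) : ℕ := if i < r then i else i + 1

lemma shiftPlace_strictMono (r : ℕ) : StrictMono (shiftPlace r) := by
  intro i j h
  unfold shiftPlace
  split_ifs <;> omega

lemma shiftPlace_of_lt {r i : ℕ} (h : i < r) : shiftPlace r i = i := if_pos h

lemma shiftPlace_of_le {r i : ℕ} (h : r ≤ i) : shiftPlace r i = i + 1 := if_neg h.not_gt

lemma shiftPlace_ne (r i : ℕ) : shiftPlace r i ≠ r := by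
  unfold shiftPlace
  split_ifs <;> omega

lemma eq_or_eq_shiftPlace {n r i : ℕ} (hr : 1 ≤ r) (hrn : r < n) (h1 : 1 ≤ i) (h2 : i ≤ n) :
    i = r ∨ ∃ j, 1 ≤ j ∧ j ≤ n - 1 ∧ i = shiftPlace r j := by
  rcases lt_trichotomy i r with h | h | h
  · exact Or.inr ⟨i, h1, by omega, (shiftPlace_of_lt h).symm⟩
  · exact Or.inl h
  · exact Or.inr ⟨i - 1, by omega, by omega, by rw [shiftPlace_of_le (by omega)]; omega⟩

lemma shiftPlace_bounds {n r j : ℕ} (hrn : r < n) (h1 : 1 ≤ j) (h2 : j ≤ n - 1) :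
    1 ≤ shiftPlace r j ∧ shiftPlace r j ≤ n := by
  unfold shiftPlace
  split_ifs <;> omega

section Insertion

variable (n r : ℕ) (π : Equiv.Perm (Fin (n - 1)))

/-- The word obtained from `π` by inserting the letter `n` at position `r`. -/
def insertMax (i : ℕ) : ℕ := if i < r then pval π i else if i = r then n else pval π (i - 1)

/-- The `r`-level excedance letters of `π`, together with `n`. -/
def excLetters : Finset ℕ := insert n ((excpSet r π).image (pval π))

/-- The word `insertMax` with its `r`-level excedance letters cyclically raised. -/
noncomputable def raisedWord (i : ℕ) : ℕ := cyclicSucc (excLetters n r π) (insertMax n r π i)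

/-- The position `r` and the `r`-level excedance places below it. -/
def lowPlaces : Finset ℕ := insert r ((excpSet r π).filter (· < r))

/-- The letters of `raisedWord` at the positions `lowPlaces`. -/
noncomputable def lowLetters : Finset ℕ := (lowPlaces n r π).image (raisedWord n r π)

/-- The word `raisedWord` with its letters at `lowPlaces` rearranged so that the letter at
position `r` is `v` and the other ones keep their relative order. -/
noncomputable def insertedWord (v i : ℕ) : ℕ :=
  (cyclicSucc ((lowLetters n r π).filter (· ≤ v))).symm (raisedWord n r π i)

variable {n r π}

lemma mem_excpSet {i : ℕ} :
    i ∈ excpSet r π ↔ (1 ≤ i ∧ i ≤ n - 1) ∧ i < pval π i ∧ r ≤ pval π i := by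
  simp [excpSet]

lemma insertMax_shiftPlace (i : ℕ) : insertMax n r π (shiftPlace r i) = pval π i := by
  unfold insertMax shiftPlace
  split_ifs <;> first | rfl | omega

lemma insertMax_self : insertMax n r π r = n := by
  simp [insertMax]

lemma mem_excLetters {i : ℕ} (hi : i ∈ excpSet r π) : pval π i ∈ excLetters n r π :=
  Finset.mem_insert_of_mem (Finset.mem_image_of_mem _ hi)

lemma top_mem_excLetters : n ∈ excLetters n r π := Finset.mem_insert_self _ _

lemma excLetters_bounds (hrn : r < n) {y : ℕ} (hy : y ∈ excLetters n r π) :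
    r ≤ y ∧ y ≤ n := by
  rcases Finset.mem_insert.1 hy with rfl | hy
  · omega
  · obtain ⟨i, hi, rfl⟩ := Finset.mem_image.1 hy
    rw [mem_excpSet] at hi
    have := pval_mem π hi.1.1 hi.1.2
    omega

lemma image_insertMax :
    (insert r ((excpSet r π).image (shiftPlace r))).image (insertMax n r π)
      = excLetters n r π := by
  rw [Finset.image_insert, insertMax_self, Finset.image_image, excLetters]
  congr 1
  exact Finset.image_congr fun i _ => insertMax_shiftPlace i

lemma lowPlaces_subset :
    lowPlaces n r π ⊆ insert r ((excpSet r π).image (shiftPlace r)) := by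
  refine Finset.insert_subset_insert _ fun i hi => ?_
  rw [Finset.mem_filter] at hi
  exact Finset.mem_image.2 ⟨i, hi.1, shiftPlace_of_lt hi.2⟩

lemma image_raisedWord :
    (insert r ((excpSet r π).image (shiftPlace r))).image (raisedWord n r π)
      = excLetters n r π := by
  conv_rhs => rw [← image_cyclicSucc (Finset.Subset.refl (excLetters n r π)),
    ← image_insertMax, Finset.image_image]
  rw [image_insertMax]
  rfl

lemma lowLetters_subset : lowLetters n r π ⊆ excLetters n r π := by
  rw [← image_raisedWord]
  exact Finset.image_subset_image lowPlaces_subset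

lemma filter_lowLetters_subset (v : ℕ) :
    (lowLetters n r π).filter (· ≤ v) ⊆ lowLetters n r π := Finset.filter_subset _ _

lemma image_insertedWord (v : ℕ) :
    (insert r ((excpSet r π).image (shiftPlace r))).image (insertedWord n r π v)
      = excLetters n r π := by
  conv_rhs => rw [← image_cyclicSucc_symm
    ((filter_lowLetters_subset v).trans (lowLetters_subset (π := π))),
    ← image_raisedWord, Finset.image_image]
  rfl

lemma image_insertedWord_lowPlaces (v : ℕ) :
    (lowPlaces n r π).image (insertedWord n r π v) = lowLetters n r π := by
  conv_rhs => rw [← image_cyclicSucc_symm (filter_lowLetters_subset (π := π) v),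
    lowLetters, Finset.image_image]
  rfl

lemma insertMax_injOn (hr : 1 ≤ r) (hrn : r < n) {i j : ℕ} (hi : 1 ≤ i) (hi' : i ≤ n)
    (hj : 1 ≤ j) (hj' : j ≤ n) (h : insertMax n r π i = insertMax n r π j) : i = j := by
  rcases eq_or_eq_shiftPlace hr hrn hi hi' with rfl | ⟨a, ha, ha', rfl⟩ <;>
  rcases eq_or_eq_shiftPlace hr hrn hj hj' with rfl | ⟨b, hb, hb', rfl⟩
  · rfl
  · rw [insertMax_self, insertMax_shiftPlace] at h
    have := pval_mem π hb hb'
    omega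
  · rw [insertMax_self, insertMax_shiftPlace] at h
    have := pval_mem π ha ha'
    omega
  · rw [insertMax_shiftPlace, insertMax_shiftPlace] at h
    rw [pval_injOn π ⟨ha, ha'⟩ ⟨hb, hb'⟩ h]

lemma raisedWord_injOn (hr : 1 ≤ r) (hrn : r < n) {i j : ℕ} (hi : 1 ≤ i) (hi' : i ≤ n)
    (hj : 1 ≤ j) (hj' : j ≤ n) (h : raisedWord n r π i = raisedWord n r π j) : i = j :=
  insertMax_injOn hr hrn hi hi' hj hj' ((cyclicSucc _).injective h)

lemma insertedWord_injOn (hr : 1 ≤ r) (hrn : r < n) (v : ℕ) {i j : ℕ} (hi : 1 ≤ i)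
    (hi' : i ≤ n) (hj : 1 ≤ j) (hj' : j ≤ n)
    (h : insertedWord n r π v i = insertedWord n r π v j) : i = j :=
  raisedWord_injOn hr hrn hi hi' hj hj' ((cyclicSucc _).symm.injective h)

lemma pval_notMem_excLetters {i : ℕ} (h1 : 1 ≤ i) (h2 : i ≤ n - 1)
    (hi : i ∉ excpSet r π) : pval π i ∉ excLetters n r π := by
  intro h
  rcases Finset.mem_insert.1 h with h | h
  · have := pval_mem π h1 h2
    omega
  · obtain ⟨j, hj, hij⟩ := Finset.mem_image.1 h
    rw [pval_injOn π (mem_excpSet.1 hj).1 ⟨h1, h2⟩ hij] at hj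
    exact hi hj

lemma insertedWord_of_notMem (v : ℕ) {i : ℕ} (h1 : 1 ≤ i) (h2 : i ≤ n - 1)
    (hi : i ∉ excpSet r π) : insertedWord n r π v (shiftPlace r i) = pval π i := by
  have h := pval_notMem_excLetters h1 h2 hi
  rw [insertedWord, raisedWord, insertMax_shiftPlace,
    (cyclicSucc_spec _).apply_of_notMem _ h]
  exact cyclicSucc_symm_of_notMem fun hW =>
    h (lowLetters_subset (filter_lowLetters_subset v hW))

lemma pval_lt_top {i : ℕ} (hi : i ∈ excpSet r π) : pval π i < n := by
  have h := (mem_excpSet.1 hi).1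
  have := pval_mem π h.1 h.2
  omega

lemma pval_lt_raisedWord {i : ℕ} (hi : i ∈ excpSet r π) :
    pval π i < raisedWord n r π (shiftPlace r i) := by
  rw [raisedWord, insertMax_shiftPlace]
  exact (cyclicSucc_spec _).lt_apply _ (mem_excLetters hi) _ top_mem_excLetters (pval_lt_top hi)

lemma raisedWord_lt_iff {i j : ℕ} (hi : i ∈ excpSet r π) (hj : j ∈ excpSet r π) :
    raisedWord n r π (shiftPlace r i) < raisedWord n r π (shiftPlace r j)
      ↔ pval π i < pval π j := by
  rw [raisedWord, insertMax_shiftPlace, raisedWord, insertMax_shiftPlace]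
  have key : ∀ {a b}, a ∈ excpSet r π → b ∈ excpSet r π → pval π a < pval π b →
      cyclicSucc (excLetters n r π) (pval π a) < cyclicSucc (excLetters n r π) (pval π b) :=
    fun ha hb h => cyclicSucc_lt_cyclicSucc (mem_excLetters ha) (mem_excLetters hb)
      top_mem_excLetters h (pval_lt_top hb)
  refine ⟨fun h => ?_, key hi hj⟩
  by_contra hcon
  rcases eq_or_lt_of_le (not_lt.1 hcon) with he | hlt
  · rw [he] at h
    exact h.false
  · exact (key hj hi hlt).not_gt h

lemma raisedWord_self_le (hrn : r < n) {y : ℕ} (hy : y ∈ excLetters n r π) :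
    raisedWord n r π r ≤ y := by
  rw [raisedWord, insertMax_self]
  exact (cyclicSucc_spec _).apply_max_le _ top_mem_excLetters
    (fun z hz => (excLetters_bounds hrn hz).2) y hy

lemma raisedWord_mem {i : ℕ} (hi : i ∈ excpSet r π) :
    raisedWord n r π (shiftPlace r i) ∈ excLetters n r π := by
  rw [raisedWord, insertMax_shiftPlace]
  exact (cyclicSucc_spec _).apply_mem _ (mem_excLetters hi)

lemma raisedWord_self_mem : raisedWord n r π r ∈ lowLetters n r π :=
  Finset.mem_image_of_mem _ (Finset.mem_insert_self _ _)

lemma lowPlaces_bounds (hr : 1 ≤ r) {i : ℕ} (hi : i ∈ lowPlaces n r π) : 1 ≤ i ∧ i ≤ r := by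
  rcases Finset.mem_insert.1 hi with rfl | hi
  · omega
  · rw [Finset.mem_filter, mem_excpSet] at hi
    omega

lemma raisedWord_notMem_lowLetters (hr : 1 ≤ r) (hrn : r < n) {i : ℕ}
    (hi : r ≤ i) (hi' : i ≤ n - 1) : raisedWord n r π (i + 1) ∉ lowLetters n r π := by
  intro h
  obtain ⟨j, hj, hij⟩ := Finset.mem_image.1 h
  have hb := lowPlaces_bounds hr hj
  have := raisedWord_injOn hr hrn hb.1 (by omega) (by omega) (by omega) hij
  omega

lemma insertedWord_of_le (hr : 1 ≤ r) (hrn : r < n) (v : ℕ) {i : ℕ}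
    (hi : r ≤ i) (hi' : i ≤ n - 1) :
    insertedWord n r π v (i + 1) = raisedWord n r π (i + 1) :=
  cyclicSucc_symm_of_notMem fun h =>
    raisedWord_notMem_lowLetters hr hrn hi hi' (filter_lowLetters_subset v h)

lemma insertedWord_self (hrn : r < n) {v : ℕ} (hv : v ∈ lowLetters n r π) :
    insertedWord n r π v r = v := by
  refine cyclicSucc_symm_min (Finset.mem_filter.2 ⟨raisedWord_self_mem,
    raisedWord_self_le hrn (lowLetters_subset hv)⟩) (Finset.mem_filter.2 ⟨hv, le_rfl⟩)
    (fun y hy => raisedWord_self_le hrn (lowLetters_subset (Finset.mem_filter.1 hy).1))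
    fun y hy => (Finset.mem_filter.1 hy).2

lemma insertedWord_lt_of_lt (hr : 1 ≤ r) (hrn : r < n) {v : ℕ} (hv : v ∈ lowLetters n r π)
    {i j : ℕ} (hi : i ∈ excpSet r π) (hir : i < r) (hj : j ∈ excpSet r π) (hjr : j < r)
    (h : pval π i < pval π j) : insertedWord n r π v i < insertedWord n r π v j := by
  have hlow : ∀ {k}, k ∈ excpSet r π → k < r → raisedWord n r π k ∈ lowLetters n r π :=
    fun hk hkr => Finset.mem_image_of_mem _
      (Finset.mem_insert_of_mem (Finset.mem_filter.2 ⟨hk, hkr⟩))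
  have hne : raisedWord n r π r ≠ raisedWord n r π i := fun he => by
    have := raisedWord_injOn hr hrn hr hrn.le (mem_excpSet.1 hi).1.1 (by omega) he
    omega
  have hlt : raisedWord n r π i < raisedWord n r π j := by
    have := (raisedWord_lt_iff hi hj).2 h
    rwa [shiftPlace_of_lt hir, shiftPlace_of_lt hjr] at this
  have hmin : raisedWord n r π r < raisedWord n r π i :=
    lt_of_le_of_ne (raisedWord_self_le hrn (lowLetters_subset (hlow hi hir))) hne
  have hminmem : raisedWord n r π r ∈ (lowLetters n r π).filter (· ≤ v) :=
    Finset.mem_filter.2 ⟨raisedWord_self_mem, raisedWord_self_le hrn (lowLetters_subset hv)⟩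
  unfold insertedWord
  by_cases hjv : raisedWord n r π j ≤ v
  · have hiF : raisedWord n r π i ∈ (lowLetters n r π).filter (· ≤ v) :=
      Finset.mem_filter.2 ⟨hlow hi hir, hlt.le.trans hjv⟩
    have hjF : raisedWord n r π j ∈ (lowLetters n r π).filter (· ≤ v) :=
      Finset.mem_filter.2 ⟨hlow hj hjr, hjv⟩
    exact cyclicSucc_symm_lt_symm hminmem hiF hjF hmin hlt
  · have hjF : raisedWord n r π j ∉ (lowLetters n r π).filter (· ≤ v) :=
      fun h => hjv (Finset.mem_filter.1 h).2
    rw [cyclicSucc_symm_of_notMem hjF]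
    by_cases hiv : raisedWord n r π i ≤ v
    · exact (cyclicSucc_symm_lt (Finset.mem_filter.2 ⟨hlow hi hir, hiv⟩) hminmem hmin).trans hlt
    · have hiF : raisedWord n r π i ∉ (lowLetters n r π).filter (· ≤ v) :=
        fun h => hiv (Finset.mem_filter.1 h).2
      rwa [cyclicSucc_symm_of_notMem hiF]

lemma insertedWord_lt_iff (hr : 1 ≤ r) (hrn : r < n) {v : ℕ} (hv : v ∈ lowLetters n r π)
    {i j : ℕ} (hi : i ∈ excpSet r π) (hir : i < r) (hj : j ∈ excpSet r π) (hjr : j < r) :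
    insertedWord n r π v i < insertedWord n r π v j ↔ pval π i < pval π j := by
  refine ⟨fun h => ?_, insertedWord_lt_of_lt hr hrn hv hi hir hj hjr⟩
  by_contra hcon
  rcases eq_or_lt_of_le (not_lt.1 hcon) with he | hlt
  · rw [pval_injOn π (mem_excpSet.1 hi).1 (mem_excpSet.1 hj).1 he.symm] at h
    exact h.false
  · exact (insertedWord_lt_of_lt hr hrn hv hj hjr hi hir hlt).not_gt h

lemma insertedWord_mem {v i : ℕ} (hi : i ∈ excpSet r π) :
    insertedWord n r π v (shiftPlace r i) ∈ excLetters n r π := by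
  rw [← image_insertedWord v]
  exact Finset.mem_image_of_mem _ (Finset.mem_insert_of_mem (Finset.mem_image_of_mem _ hi))

lemma insertedWord_bounds (hr : 1 ≤ r) (hrn : r < n) {v : ℕ} (hv : v ∈ lowLetters n r π)
    {i : ℕ} (h1 : 1 ≤ i) (h2 : i ≤ n) :
    1 ≤ insertedWord n r π v i ∧ insertedWord n r π v i ≤ n := by
  rcases eq_or_eq_shiftPlace hr hrn h1 h2 with rfl | ⟨j, hj, hj', rfl⟩
  · rw [insertedWord_self hrn hv]
    have := excLetters_bounds hrn (lowLetters_subset hv)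
    omega
  · by_cases hjX : j ∈ excpSet r π
    · have := excLetters_bounds hrn (insertedWord_mem (v := v) hjX)
      omega
    · rw [insertedWord_of_notMem v hj hj' hjX]
      have := pval_mem π hj hj'
      omega

variable {τ : Equiv.Perm (Fin n)} {v : ℕ}

lemma excpSet_inserted (hr : 1 ≤ r) (hrn : r < n) (hv : v ∈ lowLetters n r π)
    (hlt : raisedWord n r π r < v)
    (hτ : ∀ i, 1 ≤ i → i ≤ n → pval τ i = insertedWord n r π v i) :
    excpSet r τ = insert r ((excpSet r π).image (shiftPlace r)) := by
  have hvr := (excLetters_bounds hrn (lowLetters_subset raisedWord_self_mem)).1.trans_lt hlt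
  ext i
  simp only [excpSet, Finset.mem_filter, Finset.mem_Icc]
  rw [← excpSet]
  constructor
  · rintro ⟨⟨h1, h2⟩, h3, h4⟩
    rw [hτ i h1 h2] at h3 h4
    rcases eq_or_eq_shiftPlace hr hrn h1 h2 with rfl | ⟨j, hj, hj', rfl⟩
    · exact Finset.mem_insert_self _ _
    refine Finset.mem_insert_of_mem (Finset.mem_image_of_mem _ ?_)
    by_contra hjX
    rw [insertedWord_of_notMem v hj hj' hjX] at h3 h4
    exact hjX (mem_excpSet.2 ⟨⟨hj, hj'⟩, ((shiftPlace_strictMono r).le_apply).trans_lt h3, h4⟩)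
  · intro hi
    rcases Finset.mem_insert.1 hi with rfl | hi
    · rw [hτ i hr hrn.le, insertedWord_self hrn hv]
      omega
    obtain ⟨j, hj, rfl⟩ := Finset.mem_image.1 hi
    have hj' := mem_excpSet.1 hj
    have hb := shiftPlace_bounds hrn hj'.1.1 hj'.1.2
    have hE := (excLetters_bounds hrn (insertedWord_mem (v := v) hj)).1
    rw [hτ _ hb.1 hb.2]
    refine ⟨hb, ?_, hE⟩
    by_cases hjr : j < r
    · rw [shiftPlace_of_lt hjr] at hE ⊢
      omega
    · rw [not_lt] at hjr
      have := pval_lt_raisedWord hj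
      rw [shiftPlace_of_le hjr] at this ⊢
      rw [insertedWord_of_le hr hrn v hjr hj'.1.2]
      omega

lemma excr_eq_card_filter {m r : ℕ} (σ : Equiv.Perm (Fin m)) :
    excr r σ = ((excpSet r σ).filter (r ≤ ·)).card := by
  unfold excr excpSet
  rw [Finset.filter_filter]
  congr 1
  refine Finset.filter_congr fun i _ => ?_
  omega

lemma filter_shiftPlace_image (X : Finset ℕ) :
    (insert r (X.image (shiftPlace r))).filter (r ≤ ·)
      = insert r ((X.filter (r ≤ ·)).image (shiftPlace r)) := by
  rw [Finset.filter_insert, if_pos le_rfl, Finset.filter_image]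
  congr 2
  refine Finset.filter_congr fun i _ => ?_
  unfold shiftPlace
  split_ifs <;> omega

lemma notMem_image_shiftPlace (X : Finset ℕ) : r ∉ X.image (shiftPlace r) := fun h => by
  obtain ⟨i, -, hi⟩ := Finset.mem_image.1 h
  exact shiftPlace_ne r i hi

lemma excr_inserted (hX : excpSet r τ = insert r ((excpSet r π).image (shiftPlace r))) :
    excr r τ = excr r π + 1 := by
  rw [excr_eq_card_filter, excr_eq_card_filter, hX, filter_shiftPlace_image,
    Finset.card_insert_of_notMem (notMem_image_shiftPlace _),
    Finset.card_image_of_injective _ (shiftPlace_strictMono r).injective]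

lemma sum_shiftPlace (X : Finset ℕ) :
    ∑ i ∈ insert r (X.image (shiftPlace r)), i
      = r + (X.filter (r ≤ ·)).card + ∑ i ∈ X, i := by
  rw [Finset.sum_insert (notMem_image_shiftPlace _),
    Finset.sum_image fun _ _ _ _ h => (shiftPlace_strictMono r).injective h,
    Finset.card_filter, add_assoc, ← Finset.sum_add_distrib]
  congr 1
  refine Finset.sum_congr rfl fun i _ => ?_
  unfold shiftPlace
  split_ifs <;> omega

lemma sdiff_shiftPlace (hr : 1 ≤ r) (hrn : r < n) (X : Finset ℕ) :
    Finset.Icc 1 n \ insert r (X.image (shiftPlace r))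
      = (Finset.Icc 1 (n - 1) \ X).image (shiftPlace r) := by
  ext i
  simp only [Finset.mem_sdiff, Finset.mem_Icc, Finset.mem_insert, Finset.mem_image, not_or]
  constructor
  · rintro ⟨⟨h1, h2⟩, h3, h4⟩
    obtain ⟨j, hj, hj', rfl⟩ := (eq_or_eq_shiftPlace hr hrn h1 h2).resolve_left h3
    exact ⟨j, ⟨⟨hj, hj'⟩, fun h => h4 ⟨j, h, rfl⟩⟩, rfl⟩
  · rintro ⟨j, ⟨⟨hj, hj'⟩, hjX⟩, rfl⟩
    refine ⟨shiftPlace_bounds hrn hj hj', shiftPlace_ne r j, ?_⟩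
    rintro ⟨k, hk, hkj⟩
    exact hjX ((shiftPlace_strictMono r).injective hkj ▸ hk)

lemma card_lowPlaces_filter_insertedWord (hr : 1 ≤ r) (hrn : r < n) (y : ℕ) :
    ((lowPlaces n r π).filter (fun i => y < insertedWord n r π v i)).card
      = ((lowLetters n r π).filter (fun w => y < w)).card := by
  rw [← image_insertedWord_lowPlaces v, Finset.filter_image, Finset.card_image_of_injOn]
  intro i hi j hj h
  have hi := lowPlaces_bounds hr (Finset.mem_filter.1 hi).1
  have hj := lowPlaces_bounds hr (Finset.mem_filter.1 hj).1
  exact insertedWord_injOn hr hrn v hi.1 (by omega) hj.1 (by omega) h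

lemma card_lowPlaces_filter_raisedWord (hr : 1 ≤ r) (hrn : r < n) (y : ℕ) :
    ((lowPlaces n r π).filter (fun i => y < raisedWord n r π i)).card
      = ((lowLetters n r π).filter (fun w => y < w)).card := by
  rw [lowLetters, Finset.filter_image, Finset.card_image_of_injOn]
  intro i hi j hj h
  have hi := lowPlaces_bounds hr (Finset.mem_filter.1 hi).1
  have hj := lowPlaces_bounds hr (Finset.mem_filter.1 hj).1
  exact raisedWord_injOn hr hrn hi.1 (by omega) hj.1 (by omega) h

lemma invOn_excpSet_inserted (hr : 1 ≤ r) (hrn : r < n) (hv : v ∈ lowLetters n r π) :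
    invOn (insert r ((excpSet r π).image (shiftPlace r))) (insertedWord n r π v)
      = invOn (excpSet r π) (pval π) + ((lowLetters n r π).filter (fun w => v < w)).card := by
  set X := excpSet r π with hX
  set L := X.filter (· < r) with hL
  set R := X.filter (r ≤ ·) with hR
  have hXLR : X = L ∪ R := by
    rw [hL, hR]
    ext i
    simp only [Finset.mem_union, Finset.mem_filter]
    have := lt_or_ge i r
    tauto
  have hLX : ∀ {i}, i ∈ L → i ∈ excpSet r π ∧ i < r := fun hi => Finset.mem_filter.1 hi
  have hRX : ∀ {i}, i ∈ R → i ∈ excpSet r π ∧ r ≤ i := fun hi => Finset.mem_filter.1 hi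
  have hset : insert r (X.image (shiftPlace r)) = (L ∪ {r}) ∪ R.image (shiftPlace r) := by
    have : L.image (shiftPlace r) = L := by
      conv_rhs => rw [← Finset.image_id (s := L)]
      exact Finset.image_congr fun i hi => shiftPlace_of_lt (hLX hi).2
    rw [hXLR, Finset.image_union, this]
    ext i
    simp only [Finset.mem_insert, Finset.mem_union, Finset.mem_singleton]
    tauto
  have hlow : L ∪ {r} = lowPlaces n r π := by
    rw [lowPlaces, Finset.union_comm]
    rfl
  have hRraised : ∀ {j}, j ∈ R →
      insertedWord n r π v (shiftPlace r j) = raisedWord n r π (shiftPlace r j) := by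
    intro j hj
    rw [shiftPlace_of_le (hRX hj).2]
    exact insertedWord_of_le hr hrn v (hRX hj).2 (mem_excpSet.1 (hRX hj).1).1.2
  have hinvL : invOn L (insertedWord n r π v) = invOn L (pval π) :=
    invOn_congr fun i hi j hj _ =>
      insertedWord_lt_iff hr hrn hv (hLX hj).1 (hLX hj).2 (hLX hi).1 (hLX hi).2
  have hinvR : invOn (R.image (shiftPlace r)) (insertedWord n r π v) = invOn R (pval π) := by
    rw [invOn_image (shiftPlace_strictMono r)]
    refine invOn_congr fun i hi j hj _ => ?_
    simp only [Function.comp]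
    rw [hRraised hi, hRraised hj]
    exact raisedWord_lt_iff (hRX hj).1 (hRX hi).1
  have hinv1 : invOn {r} (insertedWord n r π v) = 0 := by
    simp [invOn]
  have hcount : (L.filter (fun i => insertedWord n r π v r < insertedWord n r π v i)).card
      = ((lowLetters n r π).filter (fun w => v < w)).card := by
    rw [insertedWord_self hrn hv, ← card_lowPlaces_filter_insertedWord (v := v) hr hrn, ← hlow,
      Finset.union_comm, ← Finset.insert_eq, Finset.filter_insert, if_neg]
    rw [insertedWord_self hrn hv]
    exact lt_irrefl v
  have hcross : ∀ j ∈ R, ((L ∪ {r}).filter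
      (fun i => insertedWord n r π v (shiftPlace r j) < insertedWord n r π v i)).card
      = (L.filter (fun i => pval π j < pval π i)).card := by
    intro j hj
    rw [hRraised hj, hlow, card_lowPlaces_filter_insertedWord hr hrn,
      ← card_lowPlaces_filter_raisedWord hr hrn, ← hlow, Finset.union_comm,
      ← Finset.insert_eq, Finset.filter_insert, if_neg]
    · congr 1
      refine Finset.filter_congr fun i hi => ?_
      rw [← raisedWord_lt_iff (hRX hj).1 (hLX hi).1, shiftPlace_of_lt (hLX hi).2]
    · exact (raisedWord_self_le hrn (raisedWord_mem (hRX hj).1)).not_gt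
  rw [hset, invOn_union, invOn_union, hinvL, hinvR, hinv1, Finset.sum_singleton, hcount,
    Finset.sum_image fun _ _ _ _ h => (shiftPlace_strictMono r).injective h,
    Finset.sum_congr rfl hcross, hXLR, invOn_union]
  · ring
  · exact fun a ha b hb => (hLX ha).2.trans_le (hRX hb).2
  · intro a ha b hb
    rw [Finset.mem_singleton.1 hb]
    exact (hLX ha).2
  · intro a ha b hb
    obtain ⟨c, hc, rfl⟩ := Finset.mem_image.1 hb
    rw [hlow] at ha
    rw [shiftPlace_of_le (hRX hc).2]
    have := lowPlaces_bounds hr ha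
    have := (hRX hc).2
    omega

lemma denr_inserted (hr : 1 ≤ r) (hrn : r < n) (hv : v ∈ lowLetters n r π)
    (hτ : ∀ i, 1 ≤ i → i ≤ n → pval τ i = insertedWord n r π v i)
    (hX : excpSet r τ = insert r ((excpSet r π).image (shiftPlace r))) :
    denr r τ = denr r π
      + (r + excr r π + ((lowLetters n r π).filter (fun w => v < w)).card) := by
  have hexc : invOn (excpSet r τ) (pval τ)
      = invOn (excpSet r τ) (insertedWord n r π v) := by
    have hb : ∀ {i}, i ∈ excpSet r τ → 1 ≤ i ∧ i ≤ n := fun hi =>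
      Finset.mem_Icc.1 (Finset.mem_filter.1 hi).1
    refine invOn_congr fun i hi j hj _ => ?_
    rw [hτ i (hb hi).1 (hb hi).2, hτ j (hb hj).1 (hb hj).2]
  have hnexc : invOn (Finset.Icc 1 n \ excpSet r τ) (pval τ)
      = invOn (Finset.Icc 1 (n - 1) \ excpSet r π) (pval π) := by
    rw [hX, sdiff_shiftPlace hr hrn, invOn_image (shiftPlace_strictMono r)]
    have hval : ∀ i ∈ Finset.Icc 1 (n - 1) \ excpSet r π,
        pval τ (shiftPlace r i) = pval π i := by
      intro i hi
      rw [Finset.mem_sdiff, Finset.mem_Icc] at hi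
      have hb := shiftPlace_bounds hrn hi.1.1 hi.1.2
      rw [hτ _ hb.1 hb.2, insertedWord_of_notMem v hi.1.1 hi.1.2 hi.2]
    refine invOn_congr fun i hi j hj _ => ?_
    simp only [Function.comp]
    rw [hval i hi, hval j hj]
  unfold denr excWord nexcWord
  rw [winv_sort_map, winv_sort_map, winv_sort_map, winv_sort_map, hexc, hnexc, hX,
    invOn_excpSet_inserted hr hrn hv, sum_shiftPlace, ← excr_eq_card_filter]
  ring

lemma inserted_mem_SnrStar (hr : 1 ≤ r) (hrn : r < n) (hv : v ∈ lowLetters n r π)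
    (hlt : raisedWord n r π r < v)
    (hτ : ∀ i, 1 ≤ i → i ≤ n → pval τ i = insertedWord n r π v i)
    (hX : excpSet r τ = insert r ((excpSet r π).image (shiftPlace r))) :
    τ ∈ SnrStar n r := by
  have hmin := (excLetters_bounds hrn (lowLetters_subset (raisedWord_self_mem (π := π)))).1
  have hτr : pval τ r = v := by rw [hτ r hr hrn.le, insertedWord_self hrn hv]
  refine ⟨?_, by rw [hτr]; omega⟩
  rintro ⟨i, hri, h1, h2, hi⟩
  have hletter : ∀ y ∈ excLetters n r π, i ≤ y → y < pval τ i → False := by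
    intro y hy hiy hyi
    rw [← image_insertedWord v, ← hX] at hy
    obtain ⟨j, hj, rfl⟩ := Finset.mem_image.1 hy
    simp only [excpSet, Finset.mem_filter, Finset.mem_Icc] at hj
    rw [← hτ j hj.1.1 hj.1.2] at hiy hyi
    rcases hi with hi | hi
    · omega
    · exact hi.2 j hj.1.1 hj.1.2 hj.2.1 ⟨hiy, hyi⟩
  rcases eq_or_eq_shiftPlace hr hrn h1 h2 with rfl | ⟨j, hj, hj', rfl⟩
  · exact hletter _ (lowLetters_subset raisedWord_self_mem) hmin (by omega)
  have hrj : r ≤ j := by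
    by_contra h
    rw [shiftPlace_of_lt (by omega)] at hri
    omega
  by_cases hjX : j ∈ excpSet r π
  · have hraise := pval_lt_raisedWord hjX
    have hval := hτ _ h1 h2
    have hjX' := mem_excpSet.1 hjX
    rw [shiftPlace_of_le hrj] at *
    rw [insertedWord_of_le hr hrn v hrj hj'] at hval
    exact hletter _ (mem_excLetters hjX) (by omega) (by omega)
  · have hval := hτ _ h1 h2
    rw [insertedWord_of_notMem v hj hj' hjX] at hval
    rw [mem_excpSet] at hjX
    rw [shiftPlace_of_le hrj] at *
    have : pval τ (j + 1) ≤ j := by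
      by_contra h
      exact hjX ⟨⟨hj, hj'⟩, by omega, by omega⟩
    rcases hi with hi | hi <;> omega

lemma exists_inserted (hr : 1 ≤ r) (hrn : r < n) {c : ℕ} (hc : (π, c) ∈ Xnr n r) :
    ∃ (τ : Equiv.Perm (Fin n)) (v : ℕ), v ∈ lowLetters n r π ∧ raisedWord n r π r < v ∧
      r + excr r π + ((lowLetters n r π).filter (fun w => v < w)).card = c ∧
      ∀ i, 1 ≤ i → i ≤ n → pval τ i = insertedWord n r π v i := by
  obtain ⟨hc1, hc2⟩ : excr r π + r - 1 < c ∧ c ≤ (excpSet r π).card + r - 1 := hc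
  have hcard : (lowLetters n r π).card = ((excpSet r π).filter (· < r)).card + 1 := by
    rw [lowLetters, Finset.card_image_of_injOn, lowPlaces, Finset.card_insert_of_notMem]
    · simp
    · intro i hi j hj h
      have hi := lowPlaces_bounds hr hi
      have hj := lowPlaces_bounds hr hj
      exact raisedWord_injOn hr hrn hi.1 (by omega) hj.1 (by omega) h
  have hsplit : ((excpSet r π).filter (· < r)).card + excr r π = (excpSet r π).card := by
    rw [excr_eq_card_filter, ← Finset.card_filter_add_card_filter_not (s := excpSet r π) (· < r)]
    simp only [not_lt]
  obtain ⟨v, hv, hvcard⟩ := exists_card_filter_gt (lowLetters n r π)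
    (t := c - (r + excr r π)) (by omega)
  obtain ⟨τ, hτ⟩ := exists_perm_pval (fun i => insertedWord_bounds hr hrn hv (i := i))
    (fun i j hi hi' hj hj' => insertedWord_injOn hr hrn v hi hi' hj hj')
  refine ⟨τ, v, hv, ?_, by omega, hτ⟩
  refine lt_of_le_of_ne (raisedWord_self_le hrn (lowLetters_subset hv)) fun he => ?_
  have : (lowLetters n r π).filter (fun w => v < w) = (lowLetters n r π).erase v := by
    ext w
    rw [Finset.mem_filter, Finset.mem_erase, and_comm]
    refine and_congr_left fun hw => ⟨fun h => h.ne', fun h => ?_⟩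
    exact lt_of_le_of_ne (he ▸ raisedWord_self_le hrn (lowLetters_subset hw)) (Ne.symm h)
  rw [this, Finset.card_erase_of_mem hv] at hvcard
  omega

lemma inserted_injective (hr : 1 ≤ r) (hrn : r < n) {π' : Equiv.Perm (Fin (n - 1))} {v' : ℕ}
    (hv : v ∈ lowLetters n r π) (hv' : v' ∈ lowLetters n r π')
    (hτ : ∀ i, 1 ≤ i → i ≤ n → pval τ i = insertedWord n r π v i)
    (hτ' : ∀ i, 1 ≤ i → i ≤ n → pval τ i = insertedWord n r π' v' i)
    (hX : excpSet r τ = insert r ((excpSet r π).image (shiftPlace r)))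
    (hX' : excpSet r τ = insert r ((excpSet r π').image (shiftPlace r))) : π = π' := by
  have hword : ∀ i, 1 ≤ i → i ≤ n → insertedWord n r π v i = insertedWord n r π' v' i :=
    fun i h1 h2 => (hτ i h1 h2).symm.trans (hτ' i h1 h2)
  have hvv : v = v' := by
    rw [← insertedWord_self hrn hv, ← insertedWord_self hrn hv', hword r hr hrn.le]
  subst hvv
  have hexc : excpSet r π = excpSet r π' := by
    have h := congrArg (Finset.erase · r) (hX.symm.trans hX')
    simp only [Finset.erase_insert (notMem_image_shiftPlace _)] at h
    exact Finset.image_injective (shiftPlace_strictMono r).injective h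
  have hletters : excLetters n r π = excLetters n r π' := by
    rw [← image_insertedWord v, ← image_insertedWord v, ← hX, ← hX']
    refine Finset.image_congr fun i hi => ?_
    have hi := Finset.mem_Icc.1 (Finset.mem_filter.1 hi).1
    exact hword i hi.1 hi.2
  have hlow : lowLetters n r π = lowLetters n r π' := by
    rw [← image_insertedWord_lowPlaces v, ← image_insertedWord_lowPlaces v,
      show lowPlaces n r π = lowPlaces n r π' by rw [lowPlaces, lowPlaces, hexc]]
    refine Finset.image_congr fun i hi => ?_
    have hi := lowPlaces_bounds hr hi
    exact hword i hi.1 (by omega)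
  refine perm_ext_pval fun i h1 h2 => ?_
  have hb := shiftPlace_bounds hrn h1 h2
  have h := hword _ hb.1 hb.2
  unfold insertedWord raisedWord at h
  rw [hlow, hletters, insertMax_shiftPlace, insertMax_shiftPlace] at h
  exact (cyclicSucc _).injective ((cyclicSucc _).symm.injective h)

end Insertion

/-- For 1 ≤ r < n there is an injection α from X_{n,r} into
S*_{n,r} with exc_r(α(π,c)) = exc_r(π) + 1 and den_r(α(π,c)) = den_r(π) + c. -/
theorem exists_injection_alpha (n r : ℕ) (hr : 1 ≤ r) (hrn : r < n) :
    ∃ α : Equiv.Perm (Fin (n - 1)) × ℕ → Equiv.Perm (Fin n),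
      Set.InjOn α (Xnr n r) ∧
      Set.MapsTo α (Xnr n r) (SnrStar n r) ∧
      ∀ p ∈ Xnr n r,
        excr r (α p) = excr r p.1 + 1 ∧ denr r (α p) = denr r p.1 + p.2 := by
  have hex : ∀ p : Equiv.Perm (Fin (n - 1)) × ℕ, p ∈ Xnr n r →
      ∃ (τ : Equiv.Perm (Fin n)) (v : ℕ), v ∈ lowLetters n r p.1 ∧ raisedWord n r p.1 r < v ∧
      r + excr r p.1 + ((lowLetters n r p.1).filter (fun w => v < w)).card = p.2 ∧
      ∀ i, 1 ≤ i → i ≤ n → pval τ i = insertedWord n r p.1 v i :=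
    fun p hp => exists_inserted hr hrn hp
  choose! α v hv hlt hcount hα using hex
  have hX : ∀ p ∈ Xnr n r,
      excpSet r (α p) = insert r ((excpSet r p.1).image (shiftPlace r)) :=
    fun p hp => excpSet_inserted hr hrn (hv p hp) (hlt p hp) (hα p hp)
  have hden : ∀ p ∈ Xnr n r, denr r (α p) = denr r p.1 + p.2 := fun p hp => by
    rw [denr_inserted hr hrn (hv p hp) (hα p hp) (hX p hp), hcount p hp]
  refine ⟨α, fun p hp q hq hpq => ?_,
    fun p hp => inserted_mem_SnrStar hr hrn (hv p hp) (hlt p hp) (hα p hp) (hX p hp),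
    fun p hp => ⟨excr_inserted (hX p hp), hden p hp⟩⟩
  have hfst : p.1 = q.1 := inserted_injective hr hrn (hv p hp) (hv q hq) (hα p hp)
    (hpq ▸ hα q hq) (hX p hp) (hpq ▸ hX q hq)
  refine Prod.ext hfst ?_
  have h := (hden p hp).symm.trans (hpq ▸ hden q hq)
  rw [hfst] at h
  omega
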